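/- arXiv:1311.4502 — 2 statements merged into one kernel-verified Lean document; each statement's English description precedes it below -/
import Mathlib

section
/- Let n be a nonnegative integer and let a, b, c ∈ ℂ satisfy c + j ≠ 0 and 1−b+j ≠ 0 for 0 ≤ j ≤ n−1, 1−c−n+j ≠ 0 for 0 ≤ j ≤ ⌊n/2⌋, and c−a+n+j ≠ 0 for 0 ≤ j ≤ ⌊(n+1)/2⌋−1. Then ((c−a)_n (a−b)_n)/((c)_n (1−b)_n) = Σ_{k=0}^{⌊n/2⌋} C(n,2k) (1−c−k) (a−b−c+1)_k (1−a)_{2k} (c−a)_k (b+c−a)_k / ((c−a+n)_k (1−c−n)_{k+1} (1−b)_{2k} (c)_k) − Σ_{0 ≤ 2k+1 ≤ n} C(n,2k+1) (c−a+3k+1) (a−b−c+1)_{k+1} (1−a)_{2k+1} (c−a)_k (b+c−a)_k / ((c−a+n)_{k+1} (1−c−n)_{k+1} (1−b)_{2k+1} (c)_k). (Second-type reciprocal relation dual to the Pfaff–Saalschütz summation theorem, first form.) -/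
/-- Rising factorial (Pochhammer symbol) of a complex number:
`poch x 0 = 1` and `poch x (m+1) = poch x m * (x + m)`. -/
noncomputable def poch (x : ℂ) : ℕ → ℂ
  | 0 => 1
  | m + 1 => poch x m * (x + (m : ℂ))

theorem poch_shift (x : ℂ) (k : ℕ) : x * poch (x + 1) k = poch x k * (x + k) := by
  induction k with
  | zero => simp [poch]
  | succ k ih =>
    simp only [poch]
    rw [← mul_assoc, ih]
    push_cast
    ring

theorem poch_ne_zero (x : ℂ) (k : ℕ) (h : ∀ j : ℕ, j < k → x + (j : ℂ) ≠ 0) : poch x k ≠ 0 := by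
  induction k with
  | zero => simp [poch]
  | succ k ih =>
    simp only [poch]
    exact mul_ne_zero (ih fun j hj => h j (by omega)) (h k (by omega))

/-- Even-indexed summand. -/
noncomputable def evT (n : ℕ) (a b c : ℂ) (k : ℕ) : ℂ :=
  (n.choose (2 * k) : ℂ) *
    ((1 - c - (k : ℂ)) * poch (a - b - c + 1) k * poch (1 - a) (2 * k) *
      poch (c - a) k * poch (b + c - a) k) /
    (poch (c - a + (n : ℂ)) k * poch (1 - c - (n : ℂ)) (k + 1) *
      poch (1 - b) (2 * k) * poch c k)

/-- Odd-indexed summand. -/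
noncomputable def odT (n : ℕ) (a b c : ℂ) (k : ℕ) : ℂ :=
  (n.choose (2 * k + 1) : ℂ) *
    ((c - a + 3 * (k : ℂ) + 1) * poch (a - b - c + 1) (k + 1) *
      poch (1 - a) (2 * k + 1) * poch (c - a) k * poch (b + c - a) k) /
    (poch (c - a + (n : ℂ)) (k + 1) * poch (1 - c - (n : ℂ)) (k + 1) *
      poch (1 - b) (2 * k + 1) * poch c k)

/-- Common factor. -/
noncomputable def uT (n : ℕ) (a b c : ℂ) (k : ℕ) : ℂ :=
  (n.choose (2 * k) : ℂ) *
    (poch (a - b - c + 1) k * poch (1 - a) (2 * k) * poch (c - a) k * poch (b + c - a) k) /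
    (poch (c - a + (n : ℂ)) k * poch (1 - c - (n : ℂ)) (k + 1) *
      poch (1 - b) (2 * k) * poch c k)

/-- Telescoping certificate. -/
noncomputable def gT (n : ℕ) (a b c : ℂ) (k : ℕ) : ℂ :=
  uT n a b c k * (-2 * k * (1 - c - n + k) / n)

/-- Intermediate certificate. -/
noncomputable def hT (n : ℕ) (a b c : ℂ) (k : ℕ) : ℂ :=
  uT n a b c k * ((n - 2 * k) / n * ((1 - c + k) + (a - b) * (c - a + k) / (1 - b + 2 * k)))

theorem evT_eq (n : ℕ) (a b c : ℂ) (k : ℕ) : evT n a b c k = (1 - c - k) * uT n a b c k := by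
  unfold evT uT
  ring

theorem odT_zero (n : ℕ) (a b c : ℂ) (k : ℕ) (h : n < 2 * k + 1) : odT n a b c k = 0 := by
  unfold odT
  rw [Nat.choose_eq_zero_of_lt h]
  simp

theorem uT_zero (n : ℕ) (a b c : ℂ) (k : ℕ) (h : n < 2 * k) : uT n a b c k = 0 := by
  unfold uT
  rw [Nat.choose_eq_zero_of_lt h]
  simp

theorem evT_shift (N : ℕ) (a b c : ℂ) (k : ℕ) (hk : 2 * k ≤ N)
    (hck : c + (k : ℂ) ≠ 0) (hbk : 1 - b + 2 * (k : ℂ) ≠ 0) :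
    (c - a) * (a - b) / (c * (1 - b)) * evT N a (b - 1) (c + 1) k =
      -uT (N + 1) a b c k * ((a - b) * ((N + 1 : ℕ) - 2 * k) * (c - a + k) /
        ((N + 1 : ℕ) * (1 - b + 2 * k))) := by
  have e1 : a - (b - 1) - (c + 1) + 1 = a - b - c + 1 := by ring
  have e2 : c + 1 - a = c - a + 1 := by ring
  have e3 : b - 1 + (c + 1) - a = b + c - a := by ring
  have e4 : c - a + 1 + (N : ℂ) = c - a + (N + 1 : ℕ) := by push_cast; ring
  have e5 : 1 - (c + 1) - (N : ℂ) = 1 - c - (N + 1 : ℕ) := by push_cast; ring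
  have e6 : 1 - (b - 1) = 1 - b + 1 := by ring
  have s1 := poch_shift (c - a) k
  have s2 := poch_shift (1 - b) (2 * k)
  have s3 := poch_shift c k
  have hC : (N.choose (2 * k) : ℂ) = ((N + 1).choose (2 * k) : ℂ) *
      ((N + 1 : ℕ) - 2 * k) / (N + 1 : ℕ) := by
    have := Nat.choose_mul_succ_eq N (2 * k)
    have hN : ((N + 1 : ℕ) : ℂ) ≠ 0 := by exact_mod_cast Nat.succ_ne_zero N
    rw [eq_div_iff hN]
    have h2 : ((N + 1 - 2 * k : ℕ) : ℂ) = (N + 1 : ℕ) - 2 * k := by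
      rw [Nat.cast_sub (by omega)]; push_cast; ring
    rw [← h2]
    exact_mod_cast this
  unfold evT uT
  rw [e1, e2, e3, e4, e5, e6, hC]
  have hN : ((N + 1 : ℕ) : ℂ) ≠ 0 := by exact_mod_cast Nat.succ_ne_zero N
  push_cast at s2
  generalize ((N + 1 : ℕ) : ℂ) = n at *
  generalize ((N + 1).choose (2 * k) : ℂ) = C at *
  generalize poch (a - b - c + 1) k = A at *
  generalize poch (1 - a) (2 * k) = P at *
  generalize poch (c - a + 1) k = Q' at *
  generalize poch (c - a) k = Q at *
  generalize poch (b + c - a) k = B at *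
  generalize poch (c - a + n) k = D at *
  generalize poch (1 - c - n) (k + 1) = F at *
  generalize poch (1 - b + 1) (2 * k) = P2 at *
  generalize poch (1 - b) (2 * k) = P1 at *
  generalize poch (c + 1) k = R' at *
  generalize poch c k = R at *
  calc _ = C * (n - 2 * k) / n * ((a - b) * (1 - (c + 1) - k) * A * P * ((c - a) * Q') * B) /
        (D * F * ((1 - b) * P2) * (c * R')) := by
          rw [div_mul_div_comm]; congr 1 <;> ring
    _ = _ := by
      rw [s1, s2, s3]
      have : 1 - (c + 1) - (k : ℂ) = -(c + k) := by ring
      rw [this]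
      have e : C * (n - 2 * k) / n * ((a - b) * -(c + k) * A * P * (Q * (c - a + k)) * B) /
          (D * F * (P1 * (1 - b + 2 * k)) * (R * (c + k))) =
          (-(C * (n - 2 * k) / n * ((a - b) * A * P * (Q * (c - a + k)) * B)) * (c + k)) /
          ((D * F * (P1 * (1 - b + 2 * k)) * R) * (c + k)) := by
        congr 1 <;> ring
      rw [e, mul_div_mul_right _ _ hck]
      generalize 1 - b + 2 * (k : ℂ) = W at *
      ring

theorem odT_shift (N : ℕ) (a b c : ℂ) (k : ℕ) (hk : 2 * k + 1 ≤ N) :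
    (c - a) * (a - b) / (c * (1 - b)) * odT N a (b - 1) (c + 1) k =
      ((N + 1).choose (2 * k + 1) : ℂ) * ((N + 1 : ℕ) - (2 * k + 1)) / (N + 1 : ℕ) *
        ((a - b) * (c - a + 3 * (k : ℂ) + 2) * poch (a - b - c + 1) (k + 1) *
      poch (1 - a) (2 * k + 1) * (poch (c - a) k * (c - a + k)) * poch (b + c - a) k) /
    (poch (c - a + (N + 1 : ℕ)) (k + 1) * poch (1 - c - (N + 1 : ℕ)) (k + 1) *
      (poch (1 - b) (2 * k + 1) * (1 - b + (2 * k + 1))) * (poch c k * (c + k))) := by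
  have e1 : a - (b - 1) - (c + 1) + 1 = a - b - c + 1 := by ring
  have e2 : c + 1 - a = c - a + 1 := by ring
  have e3 : b - 1 + (c + 1) - a = b + c - a := by ring
  have e4 : c - a + 1 + (N : ℂ) = c - a + (N + 1 : ℕ) := by push_cast; ring
  have e5 : 1 - (c + 1) - (N : ℂ) = 1 - c - (N + 1 : ℕ) := by push_cast; ring
  have e6 : 1 - (b - 1) = 1 - b + 1 := by ring
  have s1 := poch_shift (c - a) k
  have s2 := poch_shift (1 - b) (2 * k + 1)
  have s3 := poch_shift c k
  have hC : (N.choose (2 * k + 1) : ℂ) = ((N + 1).choose (2 * k + 1) : ℂ) *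
      ((N + 1 : ℕ) - (2 * k + 1)) / (N + 1 : ℕ) := by
    have := Nat.choose_mul_succ_eq N (2 * k + 1)
    have hN : ((N + 1 : ℕ) : ℂ) ≠ 0 := by exact_mod_cast Nat.succ_ne_zero N
    rw [eq_div_iff hN]
    have h2 : ((N + 1 - (2 * k + 1) : ℕ) : ℂ) = (N + 1 : ℕ) - (2 * k + 1) := by
      rw [Nat.cast_sub (by omega)]; push_cast; ring
    rw [← h2]
    exact_mod_cast this
  unfold odT
  rw [e1, e2, e3, e4, e5, e6, hC]
  push_cast at s2
  rw [← s1, ← s2, ← s3, div_mul_div_comm]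
  congr 1 <;> ring

theorem even_step (N : ℕ) (a b c : ℂ) (k : ℕ) (hk : 2 * k ≤ N + 1)
    (hc : ∀ j : ℕ, j < N + 1 → c + (j : ℂ) ≠ 0)
    (hb : ∀ j : ℕ, j < N + 1 → 1 - b + (j : ℂ) ≠ 0) :
    evT (N + 1) a b c k - (c - a) * (a - b) / (c * (1 - b)) * evT N a (b - 1) (c + 1) k =
      hT (N + 1) a b c k - gT (N + 1) a b c k := by
  have hN : ((N + 1 : ℕ) : ℂ) ≠ 0 := by exact_mod_cast Nat.succ_ne_zero N
  rcases Nat.lt_or_ge N (2 * k) with h | h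
  · have h2 : 2 * k = N + 1 := by omega
    have h3 : ((N + 1 : ℕ) : ℂ) = 2 * k := by rw [← h2]; push_cast; ring
    rw [evT_eq, evT_eq N, uT_zero N _ _ _ _ h]
    unfold hT gT
    rw [h3] at hN ⊢
    have hk0 : (k : ℂ) ≠ 0 := by intro h0; simp [h0] at hN
    rw [sub_self, zero_div]
    field_simp
    ring
  · have hbk : 1 - b + 2 * (k : ℂ) ≠ 0 := by
      have := hb (2 * k) (by omega)
      push_cast at this
      exact this
    rw [evT_shift N a b c k h (hc k (by omega)) hbk, evT_eq]
    unfold hT gT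
    field_simp
    ring

theorem odd_step (N : ℕ) (a b c : ℂ) (k : ℕ) (hk : 2 * k + 1 ≤ N + 1)
    (hc : ∀ j : ℕ, j < N + 1 → c + (j : ℂ) ≠ 0)
    (hb : ∀ j : ℕ, j < N + 1 → 1 - b + (j : ℂ) ≠ 0)
    (hcn : ∀ j : ℕ, j ≤ (N + 1) / 2 → 1 - c - ((N + 1 : ℕ) : ℂ) + (j : ℂ) ≠ 0)
    (hca : ∀ j : ℕ, j < (N + 1 + 1) / 2 → c - a + ((N + 1 : ℕ) : ℂ) + (j : ℂ) ≠ 0) :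
    odT (N + 1) a b c k - (c - a) * (a - b) / (c * (1 - b)) * odT N a (b - 1) (c + 1) k =
      hT (N + 1) a b c k - gT (N + 1) a b c (k + 1) := by
  have hN : ((N + 1 : ℕ) : ℂ) ≠ 0 := by exact_mod_cast Nat.succ_ne_zero N
  have hbk : 1 - b + 2 * (k : ℂ) ≠ 0 := by
    have := hb (2 * k) (by omega)
    push_cast at this
    exact this
  have hck := hc k (by omega)
  have hDk := hca k (by omega)
  have hFk := hcn k (by omega)
  have hP1 : poch (1 - b) (2 * k) ≠ 0 := poch_ne_zero _ _ fun j hj => hb j (by omega)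
  have hR : poch c k ≠ 0 := poch_ne_zero _ _ fun j hj => hc j (by omega)
  have hD : poch (c - a + (N + 1 : ℕ)) k ≠ 0 := poch_ne_zero _ _ fun j hj => hca j (by omega)
  have hF : poch (1 - c - (N + 1 : ℕ)) k ≠ 0 := poch_ne_zero _ _ fun j hj => hcn j (by omega)
  have h21 : (2 * (k : ℂ) + 1) ≠ 0 := by exact_mod_cast Nat.succ_ne_zero (2 * k)
  have hC1 : ((N + 1).choose (2 * k + 1) : ℂ) = ((N + 1).choose (2 * k) : ℂ) *
      ((N + 1 : ℕ) - 2 * k) / (2 * k + 1) := by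
    rw [eq_div_iff h21]
    have := Nat.choose_succ_right_eq (N + 1) (2 * k)
    have h2 : ((N + 1 - 2 * k : ℕ) : ℂ) = (N + 1 : ℕ) - 2 * k := by
      rw [Nat.cast_sub (by omega)]; push_cast; ring
    rw [← h2]
    exact_mod_cast this
  rcases Nat.lt_or_ge N (2 * k + 1) with h | h
  · have h2 : N = 2 * k := by omega
    have h3 : ((N + 1 : ℕ) : ℂ) = 2 * k + 1 := by rw [h2]; push_cast; ring
    rw [odT_zero N _ _ _ _ h]
    have : gT (N + 1) a b c (k + 1) = 0 := by
      unfold gT; rw [uT_zero _ _ _ _ _ (by omega)]; simp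
    rw [this]
    unfold odT hT uT
    rw [hC1]
    simp only [poch]
    have e2k0 : ((2 * k : ℕ) : ℂ) = 2 * k := by push_cast; ring
    simp only [e2k0]
    clear hc hb hcn hca hC1
    generalize ((N + 1 : ℕ) : ℂ) = n at *
    generalize ((N + 1).choose (2 * k) : ℂ) = C at *
    generalize poch (a - b - c + 1) k = A at *
    generalize poch (1 - a) (2 * k) = P at *
    generalize poch (c - a) k = Q at *
    generalize poch (b + c - a) k = B at *
    generalize poch (c - a + n) k = D at *
    generalize poch (1 - c - n) k = F at *
    generalize poch (1 - b) (2 * k) = P1 at *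
    generalize poch c k = R at *
    generalize (k : ℂ) = x at *
    have hn2 : n - 2 * x = 1 := by rw [h3]; ring
    rw [hn2]
    field_simp
    rw [h3]
    ring
  · have h22 : (2 * (k : ℂ) + 2) ≠ 0 := by exact_mod_cast Nat.succ_ne_zero (2 * k + 1)
    have hC2 : ((N + 1).choose (2 * k + 2) : ℂ) = ((N + 1).choose (2 * k + 1) : ℂ) *
        ((N + 1 : ℕ) - (2 * k + 1)) / (2 * k + 2) := by
      rw [eq_div_iff h22]
      have := Nat.choose_succ_right_eq (N + 1) (2 * k + 1)
      have h2 : ((N + 1 - (2 * k + 1) : ℕ) : ℂ) = (N + 1 : ℕ) - (2 * k + 1) := by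
        rw [Nat.cast_sub (by omega)]; push_cast; ring
      rw [← h2]
      exact_mod_cast this
    have hbk1 : 1 - b + (2 * (k : ℂ) + 1) ≠ 0 := by
      have := hb (2 * k + 1) (by omega)
      push_cast at this
      exact this
    have hFk1 : 1 - c - ((N + 1 : ℕ) : ℂ) + ((k : ℂ) + 1) ≠ 0 := by
      have := hcn (k + 1) (by omega)
      push_cast at this ⊢
      exact this
    rw [odT_shift N a b c k h]
    unfold odT hT gT uT
    have e : 2 * (k + 1) = 2 * k + 2 := by ring
    rw [e, hC2, hC1]
    simp only [poch]
    push_cast [-Nat.cast_add, -Nat.cast_succ] at *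
    have ek : ((k + 1 : ℕ) : ℂ) = k + 1 := by push_cast; ring
    have e2k : ((2 * k + 1 : ℕ) : ℂ) = 2 * k + 1 := by push_cast; ring
    have e2k0 : ((2 * k : ℕ) : ℂ) = 2 * k := by push_cast; ring
    simp only [ek, e2k, e2k0]
    clear hc hb hcn hca hC1 hC2
    generalize ((N + 1 : ℕ) : ℂ) = n at *
    generalize ((N + 1).choose (2 * k) : ℂ) = C at *
    generalize poch (a - b - c + 1) k = A at *
    generalize poch (1 - a) (2 * k) = P at *
    generalize poch (c - a) k = Q at *
    generalize poch (b + c - a) k = B at *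
    generalize poch (c - a + n) k = D at *
    generalize poch (1 - c - n) k = F at *
    generalize poch (1 - b) (2 * k) = P1 at *
    generalize poch c k = R at *
    generalize (k : ℂ) = x at *
    generalize hw0 : 1 - b + 2 * x = w0 at *
    generalize hw1 : 1 - b + (2 * x + 1) = w1 at *
    generalize hd : c - a + n + x = d at *
    generalize hf0 : 1 - c - n + x = f0 at *
    generalize hf1 : 1 - c - n + (x + 1) = f1 at *
    generalize hcx : c + x = cx at *
    generalize hx1 : 2 * x + 1 = x1 at *
    have hx2 : 2 * x + 2 = 2 * (x + 1) := by ring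
    rw [hx2] at h22 ⊢
    have hx3 : x + 1 ≠ 0 := by
      intro h0
      rw [h0] at h22
      simp at h22
    field_simp
    subst hw0 hw1 hd hf0 hf1 hcx hx1
    ring

theorem sum_form (n : ℕ) (a b c : ℂ)
    (hc : ∀ j : ℕ, j < n → c + (j : ℂ) ≠ 0)
    (hb : ∀ j : ℕ, j < n → 1 - b + (j : ℂ) ≠ 0)
    (hcn : ∀ j : ℕ, j ≤ n / 2 → 1 - c - (n : ℂ) + (j : ℂ) ≠ 0)
    (hca : ∀ j : ℕ, j < (n + 1) / 2 → c - a + (n : ℂ) + (j : ℂ) ≠ 0) (M : ℕ) (hM : n / 2 + 1 ≤ M) :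
    poch (c - a) n * poch (a - b) n / (poch c n * poch (1 - b) n) =
      ∑ k ∈ Finset.range M, (evT n a b c k - odT n a b c k) := by
  induction n generalizing b c M with
  | zero =>
    obtain ⟨m, rfl⟩ : ∃ m, M = m + 1 := ⟨M - 1, by omega⟩
    rw [Finset.sum_range_succ', Finset.sum_eq_zero]
    · have h1 : 1 - c ≠ 0 := by simpa using hcn 0 (by omega)
      rw [odT_zero _ _ _ _ _ (by omega)]
      simp [evT, poch, h1]
    · intro k _
      rw [odT_zero _ _ _ _ _ (by omega), evT_eq, uT_zero _ _ _ _ _ (by omega)]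
      simp
  | succ N ih =>
    have key : ∀ k : ℕ, evT (N + 1) a b c k - odT (N + 1) a b c k -
        (c - a) * (a - b) / (c * (1 - b)) *
          (evT N a (b - 1) (c + 1) k - odT N a (b - 1) (c + 1) k) =
        gT (N + 1) a b c (k + 1) - gT (N + 1) a b c k := by
      intro k
      rcases Nat.lt_or_ge (N + 1) (2 * k) with h | h
      · rw [evT_eq, evT_eq, odT_zero _ _ _ _ _ (by omega), odT_zero _ _ _ _ _ (by omega)]
        unfold gT
        rw [uT_zero _ _ _ _ _ (by omega), uT_zero _ _ _ _ _ (by omega),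
          uT_zero _ _ _ _ _ (by omega)]
        simp
      have he := even_step N a b c k h hc hb
      rcases Nat.lt_or_ge (N + 1) (2 * k + 1) with h' | h'
      · have h3 : hT (N + 1) a b c k = 0 := by
          have : ((N + 1 : ℕ) : ℂ) = 2 * k := by
            rw [show N + 1 = 2 * k by omega]; push_cast; ring
          unfold hT
          rw [this]
          simp
        have h4 : gT (N + 1) a b c (k + 1) = 0 := by
          unfold gT; rw [uT_zero _ _ _ _ _ (by omega)]; simp
        rw [odT_zero _ _ _ _ _ (by omega), odT_zero _ _ _ _ _ (by omega), h4]
        rw [h3] at he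
        linear_combination he
      · have ho := odd_step N a b c k h' hc hb hcn hca
        linear_combination he - ho
    have hsum := Finset.sum_congr (rfl : Finset.range M = Finset.range M) (fun k _ => key k)
    rw [Finset.sum_range_sub, Finset.sum_sub_distrib, ← Finset.mul_sum] at hsum
    have hG0 : gT (N + 1) a b c 0 = 0 := by simp [gT]
    have hGM : gT (N + 1) a b c M = 0 := by
      unfold gT; rw [uT_zero _ _ _ _ _ (by omega)]; simp
    rw [hG0, hGM, sub_zero, sub_eq_zero] at hsum
    rw [hsum, ← ih (b - 1) (c + 1) _ _ _ _ M (by omega)]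
    · have e2 : c + 1 - a = c - a + 1 := by ring
      have e6 : 1 - (b - 1) = 1 - b + 1 := by ring
      have e7 : a - (b - 1) = a - b + 1 := by ring
      rw [e2, e6, e7, div_mul_div_comm]
      have t : ∀ x : ℂ, poch x (N + 1) = x * poch (x + 1) N := fun x => by
        rw [poch_shift]; rfl
      rw [t, t, t, t]
      congr 1 <;> ring
    · intro j hj
      have := hc (j + 1) (by omega)
      push_cast at this
      convert this using 1; ring
    · intro j hj
      have := hb (j + 1) (by omega)
      push_cast at this
      convert this using 1; ring
    · intro j hj
      have := hcn j (by omega)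
      push_cast at this
      convert this using 1; ring
    · intro j hj
      have := hca j (by omega)
      push_cast at this
      convert this using 1; ring

/-- Second-type reciprocal relation dual to the Pfaff–Saalschütz summation theorem,
first form. -/
theorem ps_reciprocal_second_first (n : ℕ) (a b c : ℂ)
    (hc : ∀ j : ℕ, j < n → c + (j : ℂ) ≠ 0)
    (hb : ∀ j : ℕ, j < n → 1 - b + (j : ℂ) ≠ 0)
    (hcn : ∀ j : ℕ, j ≤ n / 2 → 1 - c - (n : ℂ) + (j : ℂ) ≠ 0)
    (hca : ∀ j : ℕ, j < (n + 1) / 2 → c - a + (n : ℂ) + (j : ℂ) ≠ 0) :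
    poch (c - a) n * poch (a - b) n / (poch c n * poch (1 - b) n) =
      (∑ k ∈ Finset.range (n / 2 + 1),
        (n.choose (2 * k) : ℂ) *
          ((1 - c - (k : ℂ)) * poch (a - b - c + 1) k * poch (1 - a) (2 * k) *
            poch (c - a) k * poch (b + c - a) k) /
          (poch (c - a + (n : ℂ)) k * poch (1 - c - (n : ℂ)) (k + 1) *
            poch (1 - b) (2 * k) * poch c k)) -
      ∑ k ∈ Finset.range ((n + 1) / 2),
        (n.choose (2 * k + 1) : ℂ) *
          ((c - a + 3 * (k : ℂ) + 1) * poch (a - b - c + 1) (k + 1) *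
            poch (1 - a) (2 * k + 1) * poch (c - a) k * poch (b + c - a) k) /
          (poch (c - a + (n : ℂ)) (k + 1) * poch (1 - c - (n : ℂ)) (k + 1) *
            poch (1 - b) (2 * k + 1) * poch c k) := by
  rw [sum_form n a b c hc hb hcn hca (n / 2 + 1) le_rfl, Finset.sum_sub_distrib]
  congr 1
  symm
  apply Finset.sum_subset (f := fun k => odT n a b c k)
  · intro x hx
    simp only [Finset.mem_range] at *
    omega
  · intro x _ hx
    simp only [Finset.mem_range] at hx
    exact odT_zero _ _ _ _ _ (by omega)
end

section
/- Let n be a nonnegative integer and let a, b, c ∈ ℂ satisfy c + j ≠ 0 and 1−b+j ≠ 0 for 0 ≤ j ≤ n−1, c−a+n+j ≠ 0 for 0 ≤ j ≤ ⌊(n+1)/2⌋−1, and a−b+n+j ≠ 0 for 0 ≤ j ≤ ⌊n/2⌋. Then ((c−a)_n (a−b)_n)/((c)_n (1−b)_n) = Σ_{k=0}^{⌊n/2⌋} C(n,2k) (a−b+3k) (c−a)_k (a−b)_k (1−a)_k (a)_k (1+a−b−c)_k (b+c−a)_k / ((c−a+n)_k (a−b+n)_{k+1} (1−b)_{2k}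 (c)_{2k}) − Σ_{0 ≤ 2k+1 ≤ n} C(n,2k+1) (1+c−a+3k) (c−a)_k (a−b)_{k+1} (1−a)_k (a)_{k+1} (1+a−b−c)_{k+1} (b+c−a)_k / ((c−a+n)_{k+1} (a−b+n)_{k+1} (1−b)_{2k+1} (c)_{2k+1}). (Third-type reciprocal relation dual to the Pfaff–Saalschütz summation theorem.) -/
theorem choose_aux1 (n m : ℕ) : ((m : ℂ) + 1) * (n.choose (m + 1) : ℂ) = ((n : ℂ) - m) * (n.choose m : ℂ) := by
  rcases le_or_gt m n with h | h
  · have := Nat.choose_succ_right_eq n m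
    have h2 := congrArg (Nat.cast : ℕ → ℂ) this
    push_cast [Nat.cast_sub h] at h2
    linear_combination h2
  · rw [Nat.choose_eq_zero_of_lt h, Nat.choose_eq_zero_of_lt (by omega)]; simp

theorem choose_aux2 (m k : ℕ) : ((m : ℂ) + 1 - k) * ((m + 1).choose k : ℂ) = ((m : ℂ) + 1) * (m.choose k : ℂ) := by
  rcases le_or_gt k (m + 1) with h | h
  · have := Nat.choose_mul_succ_eq m k
    have h2 := congrArg (Nat.cast : ℕ → ℂ) this
    push_cast [Nat.cast_sub h] at h2
    linear_combination -h2
  · rw [Nat.choose_eq_zero_of_lt h, Nat.choose_eq_zero_of_lt (by omega)]; simp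

/-- product of the first `m` linear factors `A i + x` -/
noncomputable def phiProd (A : ℕ → ℂ) (x : ℂ) (m : ℕ) : ℂ := ∏ i ∈ Finset.range m, (A i + x)

theorem phiProd_succ (A : ℕ → ℂ) (x : ℂ) (m : ℕ) :
    phiProd A x (m + 1) = phiProd A x m * (A m + x) := Finset.prod_range_succ _ _

theorem gould_orth (A : ℕ → ℂ) (n k : ℕ) (hk : k ≤ n) (h : ∀ i ≤ n, A i + (n : ℂ) ≠ 0) :
    ∑ m ∈ Finset.range (n + 1), (-1 : ℂ) ^ m * (n.choose m : ℂ) * (A m + m) / phiProd A n (m + 1)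
      * ((m.choose k : ℂ) * phiProd A k m) = if k = n then (-1 : ℂ) ^ n else 0 := by
  have hphi : ∀ m ≤ n + 1, phiProd A n m ≠ 0 := fun m hm =>
    Finset.prod_ne_zero_iff.2 fun i hi => h i (by have := Finset.mem_range.1 hi; omega)
  split_ifs with hkn
  · subst hkn
    rw [Finset.sum_range_succ, Finset.sum_eq_zero]
    · have h1 := hphi k (by omega)
      have h2 := h k le_rfl
      rw [phiProd_succ, Nat.choose_self]
      field_simp
      simp
    · intro m hm
      rw [Nat.choose_eq_zero_of_lt (Finset.mem_range.1 hm)]; simp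
  · have hne : (n : ℂ) - k ≠ 0 := sub_ne_zero.2 (by exact_mod_cast (Ne.symm hkn))
    apply mul_left_cancel₀ hne
    rw [mul_zero, Finset.mul_sum]
    let U : ℕ → ℂ := fun m => (-1 : ℂ) ^ (m + 1) * ((m : ℂ) - k) * (n.choose m : ℂ) * (m.choose k : ℂ)
      * phiProd A k m / phiProd A n m
    have hU : ∀ m ∈ Finset.range (n + 1), ((n : ℂ) - k) * ((-1 : ℂ) ^ m * (n.choose m : ℂ) * (A m + m) / phiProd A n (m + 1)
      * ((m.choose k : ℂ) * phiProd A k m)) = U (m + 1) - U m := by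
      intro m hm
      have hm' := Finset.mem_range.1 hm
      have h1 := hphi m (by omega)
      have h2 := h m (by omega)
      have e : ((m : ℂ) + 1 - k) * (n.choose (m + 1) : ℂ) * ((m + 1).choose k : ℂ) =
          ((n : ℂ) - m) * (n.choose m : ℂ) * (m.choose k : ℂ) := by
        linear_combination (n.choose (m + 1) : ℂ) * choose_aux2 m k + (m.choose k : ℂ) * choose_aux1 n m
      have hU1 : U (m + 1) = (-1 : ℂ) ^ m * (((n : ℂ) - m) * (n.choose m : ℂ) * (m.choose k : ℂ))
        * phiProd A k (m + 1) / phiProd A n (m + 1) := by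
        simp only [U]; rw [← e]; push_cast; ring
      rw [hU1]
      simp only [U, phiProd_succ]
      field_simp
      ring
    rw [Finset.sum_congr rfl hU, Finset.sum_range_sub]
    simp only [U]
    rw [Nat.choose_succ_self]
    rcases k with _ | k <;> simp

theorem gould_inv (A g : ℕ → ℂ) (n : ℕ) (h : ∀ i ≤ n, A i + (n : ℂ) ≠ 0) :
    ∑ m ∈ Finset.range (n + 1), (-1 : ℂ) ^ m * (n.choose m : ℂ) * (A m + m) / phiProd A n (m + 1)
      * ∑ k ∈ Finset.range (m + 1), (-1 : ℂ) ^ k * (m.choose k : ℂ) * phiProd A k m * g k = g n := by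
  have e1 : ∀ m ∈ Finset.range (n + 1),
      ∑ k ∈ Finset.range (m + 1), (-1 : ℂ) ^ k * (m.choose k : ℂ) * phiProd A k m * g k =
      ∑ k ∈ Finset.range (n + 1), (-1 : ℂ) ^ k * (m.choose k : ℂ) * phiProd A k m * g k := by
    intro m hm
    have hm' := Finset.mem_range.1 hm
    apply Finset.sum_subset
    · intro i hi; simp at hi ⊢; omega
    · intro i _ hi
      rw [Nat.choose_eq_zero_of_lt (by simp at hi; omega)]; simp
  rw [Finset.sum_congr rfl fun m hm => by rw [e1 m hm, Finset.mul_sum], Finset.sum_comm]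
  have e2 : ∀ k ∈ Finset.range (n + 1), ∑ m ∈ Finset.range (n + 1),
      (-1 : ℂ) ^ m * (n.choose m : ℂ) * (A m + m) / phiProd A n (m + 1)
      * ((-1 : ℂ) ^ k * (m.choose k : ℂ) * phiProd A k m * g k) =
      (if k = n then (-1 : ℂ) ^ n else 0) * ((-1) ^ k * g k) := by
    intro k hk
    rw [← gould_orth A n k (by have := Finset.mem_range.1 hk; omega) h, Finset.sum_mul]
    exact Finset.sum_congr rfl fun m _ => by ring
  rw [Finset.sum_congr rfl e2]
  simp only [ite_mul, zero_mul, Finset.sum_ite_eq', Finset.mem_range, Nat.lt_succ_self, if_true]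
  rw [← mul_assoc, ← mul_pow]; simp

theorem poch_succ (x : ℂ) (m : ℕ) : poch x (m + 1) = poch x m * (x + m) := rfl

theorem poch_succ' (x : ℂ) (m : ℕ) : poch x (m + 1) = x * poch (x + 1) m := by
  induction m with
  | zero => simp [poch]
  | succ m ih => rw [poch_succ, ih, poch_succ]; push_cast; ring

theorem poch_add (x : ℂ) (m k : ℕ) : poch x (m + k) = poch x m * poch (x + m) k := by
  induction k with
  | zero => simp [poch]
  | succ k ih => rw [← add_assoc, poch_succ, ih, poch_succ]; push_cast; ring

theorem poch_swap (x : ℂ) (m k : ℕ) : poch x k * poch (x + k) m = poch x m * poch (x + m) k := by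
  rw [← poch_add, ← poch_add, add_comm]

theorem poch_ne (x : ℂ) (m : ℕ) (h : ∀ j < m, x + (j : ℂ) ≠ 0) : poch x m ≠ 0 := by
  induction m with
  | zero => simp [poch]
  | succ m ih =>
    exact mul_ne_zero (ih fun j hj => h j (by omega)) (h m (by omega))

theorem poch_neg (x : ℂ) (m : ℕ) : poch (x - m) m = (-1) ^ m * poch (1 - x) m := by
  induction m generalizing x with
  | zero => simp [poch]
  | succ m ih =>
    rw [poch_succ', poch_succ]
    have : x - ((m + 1 : ℕ) : ℂ) + 1 = x - m := by push_cast; ring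
    rw [this, ih]; push_cast; ring

theorem poch_refl (x : ℂ) (m k : ℕ) : poch (x - m) (m + k) = (-1) ^ m * poch (1 - x) m * poch x k := by
  rw [poch_add, poch_neg, sub_add_cancel]

theorem saal (n : ℕ) (x y c d : ℂ) (hd : c + d = 1 + x + y - n)
    (hc : ∀ j < n, c + (j : ℂ) ≠ 0) (hdd : ∀ j < n, d + (j : ℂ) ≠ 0) :
    ∑ k ∈ Finset.range (n + 1), (-1 : ℂ) ^ k * (n.choose k : ℂ) * (poch x k * poch y k) / (poch c k * poch d k)
      = (-1) ^ n * (poch (c - x) n * poch (c - y) n) / (poch c n * poch d n) := by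
  induction n generalizing c with
  | zero => simp [poch]
  | succ n ih =>
    have hc0 : c ≠ 0 := by simpa using hc 0 (by omega)
    have hdn : d + n ≠ 0 := hdd n (by omega)
    have hc1 : ∀ j < n, c + 1 + (j : ℂ) ≠ 0 := fun j hj => by
      have := hc (j + 1) (by omega); push_cast at this
      rwa [add_assoc, add_comm (1 : ℂ)]
    have IH := ih (c + 1) (by push_cast at hd; linear_combination hd) hc1 (fun j hj => hdd j (by omega))
    have key : ∀ M ≤ n, ∑ k ∈ Finset.range (M + 1),
        ((-1 : ℂ) ^ k * ((n + 1).choose k : ℂ) * (poch x k * poch y k) / (poch c k * poch d k)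
        - (-((c - x) * (c - y)) / (c * (d + n))) *
          ((-1 : ℂ) ^ k * (n.choose k : ℂ) * (poch x k * poch y k) / (poch (c + 1) k * poch d k)))
        = (-1) ^ M * (n.choose M : ℂ) * (poch x (M + 1) * poch y (M + 1)) /
          (poch c (M + 1) * poch d M * (d + n)) := by
      intro M
      induction M with
      | zero =>
        intro _
        simp [poch]
        field_simp
        push_cast at hd
        have : d = 1 + x + y - (n + 1) - c := by linear_combination hd
        subst this; ring
      | succ M ihM =>
        intro hM
        rw [Finset.sum_range_succ, ihM (by omega)]
        have q1 := poch_ne (c + 1) M (fun j hj => hc1 j (by omega))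
        have q2 := poch_ne d M (fun j hj => hdd j (by omega))
        have q3 : c + 1 + (M : ℂ) ≠ 0 := hc1 M (by omega)
        have q4 : d + (M : ℂ) ≠ 0 := hdd M (by omega)
        rw [poch_succ' c (M + 1), poch_succ' c M, poch_succ (c + 1), poch_succ d,
          poch_succ x (M + 1), poch_succ y (M + 1)]
        have hM1 : (M : ℂ) + 1 ≠ 0 := Nat.cast_add_one_ne_zero M
        have b1 : (n.choose (M + 1) : ℂ) = ((n : ℂ) - M) * (n.choose M : ℂ) / (M + 1) := by
          rw [eq_div_iff hM1]; linear_combination choose_aux1 n M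
        rw [Nat.choose_succ_succ]
        push_cast
        rw [b1]
        push_cast at hd
        have hde : d = 1 + x + y - (n + 1) - c := by linear_combination hd
        field_simp
        rw [hde]; ring
    have K := key n le_rfl
    rw [Finset.sum_sub_distrib, ← Finset.mul_sum, IH] at K
    rw [Finset.sum_range_succ, eq_add_of_sub_eq K]
    have q1 := poch_ne (c + 1) n hc1
    have q2 := poch_ne d n (fun j hj => hdd j (by omega))
    rw [poch_succ' c n, poch_succ d, poch_succ' (c - x), poch_succ' (c - y),
      show c - x + 1 = c + 1 - x by ring, show c - y + 1 = c + 1 - y by ring]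
    simp only [Nat.choose_self]
    field_simp
    ring

theorem sum_even_odd (F : ℕ → ℂ) (n : ℕ) : ∑ m ∈ Finset.range (n + 1), F m =
    ∑ k ∈ Finset.range (n / 2 + 1), F (2 * k) + ∑ k ∈ Finset.range ((n + 1) / 2), F (2 * k + 1) := by
  induction n with
  | zero => simp
  | succ n ih =>
    rw [Finset.sum_range_succ, ih]
    rcases Nat.even_or_odd' n with ⟨t, rfl | rfl⟩
    · rw [show 2 * t / 2 = t by omega, show (2 * t + 1) / 2 = t by omega,
        show (2 * t + 1 + 1) / 2 = t + 1 by omega, Finset.sum_range_succ (fun k => F (2 * k + 1))]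
      ring
    · rw [show (2 * t + 1) / 2 = t by omega, show (2 * t + 1 + 1) / 2 = t + 1 by omega,
        show (2 * t + 1 + 1 + 1) / 2 = t + 1 by omega, Finset.sum_range_succ (fun k => F (2 * k)) (t + 1),
        show 2 * (t + 1) = 2 * t + 1 + 1 by ring]
      ring

/-- the alternating sequence of shifts -/
noncomputable def altSeq (p q : ℂ) (m : ℕ) : ℂ := if m % 2 = 0 then p + (m / 2 : ℕ) else q + (m / 2 : ℕ)

theorem altSeq_even (p q : ℂ) (k : ℕ) : altSeq p q (2 * k) = p + k := by
  simp [altSeq]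

theorem altSeq_odd (p q : ℂ) (k : ℕ) : altSeq p q (2 * k + 1) = q + k := by
  have h1 : (2 * k + 1) % 2 ≠ 0 := by omega
  have h2 : (2 * k + 1) / 2 = k := by omega
  rw [altSeq, if_neg h1, h2]

theorem phi_even (p q x : ℂ) (k : ℕ) : phiProd (altSeq p q) x (2 * k) = poch (p + x) k * poch (q + x) k := by
  induction k with
  | zero => simp [phiProd, poch]
  | succ k ih =>
    rw [show 2 * (k + 1) = 2 * k + 1 + 1 by ring, phiProd_succ, phiProd_succ, ih, altSeq_even, altSeq_odd,
      poch_succ, poch_succ]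
    ring

theorem phi_odd (p q x : ℂ) (k : ℕ) :
    phiProd (altSeq p q) x (2 * k + 1) = poch (p + x) (k + 1) * poch (q + x) k := by
  rw [phiProd_succ, phi_even, altSeq_even, poch_succ]; ring

theorem f_even (a b c : ℂ) (m : ℕ) (hc : ∀ j < 2 * m, c + (j : ℂ) ≠ 0)
    (hb : ∀ j < 2 * m, 1 - b + (j : ℂ) ≠ 0) :
    ∑ k ∈ Finset.range (2 * m + 1), (-1 : ℂ) ^ k * ((2 * m).choose k : ℂ) *
      phiProd (altSeq (a - b) (c - a)) k (2 * m) *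
        (poch (c - a) k * poch (a - b) k / (poch c k * poch (1 - b) k)) =
    poch (c - a) m * poch (a - b) m * poch (1 - a) m * poch a m * poch (1 + a - b - c) m *
      poch (b + c - a) m / (poch (1 - b) (2 * m) * poch c (2 * m)) := by
  have S := saal (2 * m) (a - b + m) (c - a + m) c (1 - b) (by push_cast; ring) hc hb
  have e : ∀ k ∈ Finset.range (2 * m + 1), (-1 : ℂ) ^ k * ((2 * m).choose k : ℂ) *
      phiProd (altSeq (a - b) (c - a)) k (2 * m) *
        (poch (c - a) k * poch (a - b) k / (poch c k * poch (1 - b) k)) =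
      (poch (a - b) m * poch (c - a) m) * ((-1 : ℂ) ^ k * ((2 * m).choose k : ℂ) *
        (poch (a - b + m) k * poch (c - a + m) k) / (poch c k * poch (1 - b) k)) := by
    intro k _
    rw [phi_even]
    calc _ = (-1 : ℂ) ^ k * ((2 * m).choose k : ℂ) * ((poch (a - b) k * poch (a - b + k) m) *
          (poch (c - a) k * poch (c - a + k) m)) / (poch c k * poch (1 - b) k) := by ring
      _ = _ := by rw [poch_swap, poch_swap (c - a)]; ring
  rw [Finset.sum_congr rfl e, ← Finset.mul_sum, S,
    show c - (a - b + m) = b + c - a - m by ring, show c - (c - a + m) = a - m by ring, two_mul,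
    poch_refl, poch_refl, show 1 - (b + c - a) = 1 + a - b - c by ring]
  have : (-1 : ℂ) ^ (m + m) = 1 := by rw [← two_mul, pow_mul]; simp
  have h2 : (-1 : ℂ) ^ m * (-1) ^ m = 1 := by rw [← pow_add, this]
  rw [this]
  linear_combination (poch (c - a) m * poch (a - b) m * poch (1 - a) m * poch a m * poch (1 + a - b - c) m *
      poch (b + c - a) m / (poch (1 - b) (m + m) * poch c (m + m))) * h2

theorem f_odd (a b c : ℂ) (m : ℕ) (hc : ∀ j < 2 * m + 1, c + (j : ℂ) ≠ 0)
    (hb : ∀ j < 2 * m + 1, 1 - b + (j : ℂ) ≠ 0) :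
    ∑ k ∈ Finset.range (2 * m + 1 + 1), (-1 : ℂ) ^ k * ((2 * m + 1).choose k : ℂ) *
      phiProd (altSeq (a - b) (c - a)) k (2 * m + 1) *
        (poch (c - a) k * poch (a - b) k / (poch c k * poch (1 - b) k)) =
    poch (c - a) m * poch (a - b) (m + 1) * poch (1 - a) m * poch a (m + 1) *
      poch (1 + a - b - c) (m + 1) *
      poch (b + c - a) m / (poch (1 - b) (2 * m + 1) * poch c (2 * m + 1)) := by
  have S := saal (2 * m + 1) (a - b + (m + 1 : ℕ)) (c - a + m) c (1 - b) (by push_cast; ring) hc hb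
  have e : ∀ k ∈ Finset.range (2 * m + 1 + 1), (-1 : ℂ) ^ k * ((2 * m + 1).choose k : ℂ) *
      phiProd (altSeq (a - b) (c - a)) k (2 * m + 1) *
        (poch (c - a) k * poch (a - b) k / (poch c k * poch (1 - b) k)) =
      (poch (a - b) (m + 1) * poch (c - a) m) * ((-1 : ℂ) ^ k * ((2 * m + 1).choose k : ℂ) *
        (poch (a - b + (m + 1 : ℕ)) k * poch (c - a + m) k) / (poch c k * poch (1 - b) k)) := by
    intro k _
    rw [phi_odd]
    calc _ = (-1 : ℂ) ^ k * ((2 * m + 1).choose k : ℂ) * ((poch (a - b) k * poch (a - b + k) (m + 1)) *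
          (poch (c - a) k * poch (c - a + k) m)) / (poch c k * poch (1 - b) k) := by ring
      _ = _ := by rw [poch_swap, poch_swap (c - a)]; ring
  have r1 : poch (b + c - a - (m + 1 : ℕ)) (2 * m + 1) =
      (-1) ^ (m + 1) * poch (1 + a - b - c) (m + 1) * poch (b + c - a) m := by
    rw [show 2 * m + 1 = m + 1 + m by ring, poch_refl, show 1 - (b + c - a) = 1 + a - b - c by ring]
  have r2 : poch (a - m) (2 * m + 1) = (-1) ^ m * poch (1 - a) m * poch a (m + 1) := by
    rw [show 2 * m + 1 = m + (m + 1) by ring, poch_refl]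
  rw [Finset.sum_congr rfl e, ← Finset.mul_sum, S,
    show c - (a - b + (m + 1 : ℕ)) = b + c - a - (m + 1 : ℕ) by ring,
    show c - (c - a + m) = a - m by ring, r1, r2]
  have : (-1 : ℂ) ^ (2 * m + 1) = -1 := by rw [pow_succ, pow_mul]; simp
  have h2 : (-1 : ℂ) ^ m * (-1) ^ m = 1 := by rw [← pow_add, ← two_mul, pow_mul]; simp
  rw [this, pow_succ]
  linear_combination (poch (c - a) m * poch (a - b) (m + 1) * poch (1 - a) m * poch a (m + 1) *
      poch (1 + a - b - c) (m + 1) *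
      poch (b + c - a) m / (poch (1 - b) (2 * m + 1) * poch c (2 * m + 1))) * h2

/-- Third-type reciprocal relation dual to the Pfaff–Saalschütz summation theorem. -/
theorem ps_reciprocal_third (n : ℕ) (a b c : ℂ)
    (hc : ∀ j : ℕ, j < n → c + (j : ℂ) ≠ 0)
    (hb : ∀ j : ℕ, j < n → 1 - b + (j : ℂ) ≠ 0)
    (hca : ∀ j : ℕ, j < (n + 1) / 2 → c - a + (n : ℂ) + (j : ℂ) ≠ 0)
    (hab : ∀ j : ℕ, j ≤ n / 2 → a - b + (n : ℂ) + (j : ℂ) ≠ 0) :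
    poch (c - a) n * poch (a - b) n / (poch c n * poch (1 - b) n) =
      (∑ k ∈ Finset.range (n / 2 + 1),
        (n.choose (2 * k) : ℂ) *
          ((a - b + 3 * (k : ℂ)) * poch (c - a) k * poch (a - b) k * poch (1 - a) k *
            poch a k * poch (1 + a - b - c) k * poch (b + c - a) k) /
          (poch (c - a + (n : ℂ)) k * poch (a - b + (n : ℂ)) (k + 1) *
            poch (1 - b) (2 * k) * poch c (2 * k))) -
      ∑ k ∈ Finset.range ((n + 1) / 2),
        (n.choose (2 * k + 1) : ℂ) *
          ((1 + c - a + 3 * (k : ℂ)) * poch (c - a) k * poch (a - b) (k + 1) *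
            poch (1 - a) k * poch a (k + 1) * poch (1 + a - b - c) (k + 1) *
            poch (b + c - a) k) /
          (poch (c - a + (n : ℂ)) (k + 1) * poch (a - b + (n : ℂ)) (k + 1) *
            poch (1 - b) (2 * k + 1) * poch c (2 * k + 1)) := by
  have hA : ∀ i ≤ n, altSeq (a - b) (c - a) i + (n : ℂ) ≠ 0 := by
    intro i hi
    rcases Nat.even_or_odd' i with ⟨t, rfl | rfl⟩
    · rw [altSeq_even, add_right_comm]; exact hab t (by omega)
    · rw [altSeq_odd, add_right_comm]; exact hca t (by omega)
  have G := gould_inv (altSeq (a - b) (c - a))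
    (fun k => poch (c - a) k * poch (a - b) k / (poch c k * poch (1 - b) k)) n hA
  rw [← G, sum_even_odd, sub_eq_add_neg (∑ k ∈ Finset.range (n / 2 + 1), _) (∑ k ∈ Finset.range ((n + 1) / 2), _), ← Finset.sum_neg_distrib]
  congr 1
  · refine Finset.sum_congr rfl fun k hk => ?_
    have hk' := Finset.mem_range.1 hk
    rw [f_even a b c k (fun j hj => hc j (by omega)) (fun j hj => hb j (by omega)), phi_odd, altSeq_even,
      pow_mul, neg_one_sq, one_pow]
    push_cast
    rw [div_mul_div_comm]
    congr 1 <;> ring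
  · refine Finset.sum_congr rfl fun k hk => ?_
    have hk' := Finset.mem_range.1 hk
    rw [f_odd a b c k (fun j hj => hc j (by omega)) (fun j hj => hb j (by omega)),
      show 2 * k + 1 + 1 = 2 * (k + 1) by ring, phi_even, altSeq_odd,
      pow_succ, pow_mul, neg_one_sq, one_pow]
    push_cast
    rw [div_mul_div_comm, ← neg_div]
    congr 1 <;> ring
end
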